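/- Let ν = β + (s^s) + α be a partition of type 2 with β₁ = 1. Then the partition μ = β + (s^s, 1) + α, obtained from ν by adding one box at the end of row s + 1, covers ν. -/

import Mathlib

/-- A partition, 0-indexed: `f i` is the `(i+1)`-st part. A partition is a weakly
decreasing, eventually zero function `ℕ → ℕ`. -/
def IsPartition (f : ℕ → ℕ) : Prop := Antitone f ∧ ∃ N, f N = 0

/-- The number of (nonzero) parts of a partition. -/
noncomputable def plen (f : ℕ → ℕ) : ℕ := sInf {n | f n = 0}

/-- The size (weight) of a partition: the sum of its parts. -/
noncomputable def psize (f : ℕ → ℕ) : ℕ := ∑ i ∈ Finset.range (plen f), f i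

/-- Containment of partitions: `subP f g` means `f ⊆ g`, i.e. `f i ≤ g i` for all `i`. -/
def subP (f g : ℕ → ℕ) : Prop := ∀ i, f i ≤ g i

/-- The conjugate partition: `conjP f j = #{i : f i > j}` (0-indexed). -/
noncomputable def conjP (f : ℕ → ℕ) : ℕ → ℕ := fun j => Nat.card {i : ℕ // j < f i}

/-- The square partition `(s^s)`. -/
def squareP (s : ℕ) : ℕ → ℕ := fun j => if j < s then s else 0

/-- The partition `(s^s, 1)`: `s` parts equal to `s` followed by a part equal to `1`. -/
def squareP1 (s : ℕ) : ℕ → ℕ := fun j => if j < s then s else if j = s then 1 else 0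

/-- The complement of `f` in the square `(m^m)`: the `(i+1)`-st part (0-indexed `i < m`)
is `m - f (m - 1 - i)`. -/
def complP (m : ℕ) (f : ℕ → ℕ) : ℕ → ℕ := fun i => if i < m then m - f (m - 1 - i) else 0

/-- `ν + (1)`: add one box at the end of the first row. -/
def addRow1 (f : ℕ → ℕ) : ℕ → ℕ := fun j => if j = 0 then f 0 + 1 else f j

/-- `(ν, 1)`: append a part equal to `1` after the last nonzero part. -/
noncomputable def addPart1 (f : ℕ → ℕ) : ℕ → ℕ :=
  fun j => if j < plen f then f j else if j = plen f then 1 else 0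

/-- Delete the first `k` columns of a partition. -/
def colDel (k : ℕ) (f : ℕ → ℕ) : ℕ → ℕ := fun j => f j - k

/-- Delete the first `s` rows of a partition. -/
def rowDel (s : ℕ) (f : ℕ → ℕ) : ℕ → ℕ := fun j => f (j + s)

/-- The sequence whose first `m` entries are given by `f` and whose subsequent entries
are given by `g`; used to form `(η^{c,m} + γ, σ)`. -/
def appendAfter (m : ℕ) (f g : ℕ → ℕ) : ℕ → ℕ := fun i => if i < m then f i else g (i - m)

/-- The cell in row `r`, column `c` (both 0-indexed) belongs to the skew diagram
`lam/alpha`. -/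
def inShape (lam alpha : ℕ → ℕ) (r c : ℕ) : Prop := alpha r ≤ c ∧ c < lam r

/-- A Littlewood–Richardson tableau of shape `lam/alpha` and content `beta`
(for each `k`, there are `beta k` entries equal to `k + 1`): a semistandard filling of
the skew diagram whose reverse reading word is a lattice permutation.  The lattice
condition is expressed by comparing, in every prefix of the reverse reading word ending
at a cell `(r, c)` (all cells in rows above `r`, together with the cells in row `r`
weakly to the right of column `c`), the number of entries `k + 2` with the number of
entries `k + 1`. -/
structure LRTableau (lam alpha beta : ℕ → ℕ) where
  entry : ℕ → ℕ → ℕ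
  zero_outside : ∀ r c, ¬ inShape lam alpha r c → entry r c = 0
  one_le : ∀ r c, inShape lam alpha r c → 1 ≤ entry r c
  row_weak : ∀ r c₁ c₂, c₁ ≤ c₂ → inShape lam alpha r c₁ → inShape lam alpha r c₂ →
    entry r c₁ ≤ entry r c₂
  col_strict : ∀ r₁ r₂ c, r₁ < r₂ → inShape lam alpha r₁ c → inShape lam alpha r₂ c →
    entry r₁ c < entry r₂ c
  content : ∀ k : ℕ,
    Nat.card {p : ℕ × ℕ // inShape lam alpha p.1 p.2 ∧ entry p.1 p.2 = k + 1} = beta k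
  lattice : ∀ r c k : ℕ, inShape lam alpha r c →
    Nat.card {p : ℕ × ℕ // inShape lam alpha p.1 p.2 ∧
        (p.1 < r ∨ (p.1 = r ∧ c ≤ p.2)) ∧ entry p.1 p.2 = k + 2} ≤
    Nat.card {p : ℕ × ℕ // inShape lam alpha p.1 p.2 ∧
        (p.1 < r ∨ (p.1 = r ∧ c ≤ p.2)) ∧ entry p.1 p.2 = k + 1}

open Classical in
/-- The Littlewood–Richardson coefficient `c^lam_{alpha, beta}`: the number of LR
tableaux of shape `lam/alpha` and content `beta`, or `0` if `alpha ⊄ lam`. -/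
noncomputable def LRcoeff (lam alpha beta : ℕ → ℕ) : ℕ :=
  if subP alpha lam then Nat.card (LRTableau lam alpha beta) else 0

/-- `mu` covers `nu`: for every integer `m ≥ μ₁ + ℓ(μ)` and every partition `lam`,
`c^lam_{ν^{c,m}, ν'} ≤ c^lam_{μ^{c,m}, μ'}`, i.e. `s_{μ'} s_{μ^c} - s_{ν'} s_{ν^c}`
is Schur-positive (complements taken in `(m^m)`). -/
def Covers (mu nu : ℕ → ℕ) : Prop :=
  ∀ m : ℕ, mu 0 + plen mu ≤ m → ∀ lam : ℕ → ℕ, IsPartition lam →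
    LRcoeff lam (complP m nu) (conjP nu) ≤ LRcoeff lam (complP m mu) (conjP mu)

/-- The partition `(i^{s+1}, i, i-1, ..., 2, 1)` (as a 0-indexed function). -/
def betaShape (i s : ℕ) : ℕ → ℕ := fun j => if j ≤ s + 1 then i else i + s + 1 - j

/-- A partition is of type 1 if it contains `(i, i, i-1, ..., 2, 1)` where `i` is its
first part. -/
def Type1 (nu : ℕ → ℕ) : Prop := IsPartition nu ∧ subP (betaShape (nu 0) 0) nu

/-- `nu = beta + (s^s) + alpha` (componentwise) is a type-2 decomposition: `s ≥ 1`,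
`alpha` is a nonempty partition with at most `s` parts, and `beta` is a (possibly empty)
partition containing `(i^{s+1}, i, i-1, ..., 2, 1)` where `i = beta 0`. -/
def IsType2Decomp (nu beta : ℕ → ℕ) (s : ℕ) (alpha : ℕ → ℕ) : Prop :=
  IsPartition beta ∧ IsPartition alpha ∧ 1 ≤ s ∧ alpha 0 ≠ 0 ∧ plen alpha ≤ s ∧
    subP (betaShape (beta 0) s) beta ∧ ∀ j, nu j = beta j + squareP s j + alpha j

/-- A partition is of type 2 if it admits a type-2 decomposition. -/
def Type2 (nu : ℕ → ℕ) : Prop := ∃ beta s alpha, IsType2Decomp nu beta s alpha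

/-- A self-conjugate partition. -/
def SelfConjugate (t : ℕ → ℕ) : Prop := ∀ j, conjP t j = t j

/-- A partition `nu` is corner-symmetric if for every outer corner of `nu` in row
`r + 1 ≥ 2` (1-indexed), i.e. every 0-indexed row `r ≥ 1` with `nu r < nu (r-1)`
(the corner cell lying in 0-indexed column `nu r`), there is a nonempty partition
`η ⊆ nu` such that the skew diagram `nu/η` is, up to translation, the Young diagram of
a self-conjugate partition, contains the cell `(r-1, nu r)` (0-indexed), and contains
no cell in any column of 0-indexed column index `< nu r`. -/
def CornerSymmetric (nu : ℕ → ℕ) : Prop :=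
  ∀ r : ℕ, 1 ≤ r → nu r < nu (r - 1) →
    ∃ η : ℕ → ℕ, IsPartition η ∧ subP η nu ∧ η 0 ≠ 0 ∧
      ∃ t : ℕ → ℕ, ∃ r0 c0 : ℕ, IsPartition t ∧ SelfConjugate t ∧
        (∀ a b : ℕ, (η a ≤ b ∧ b < nu a) ↔ (r0 ≤ a ∧ c0 ≤ b ∧ b - c0 < t (a - r0))) ∧
        η (r - 1) ≤ nu r ∧
        (∀ a b : ℕ, η a ≤ b → b < nu a → nu r ≤ b)

open Finset in
/-- The sum of the first `r` values of `f`. -/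
def rowSum (f : ℕ → ℕ) (r : ℕ) : ℕ := ∑ i ∈ range r, f i

@[simp] lemma rowSum_zero (f : ℕ → ℕ) : rowSum f 0 = 0 := by simp [rowSum]

lemma rowSum_succ (f : ℕ → ℕ) (r : ℕ) : rowSum f (r + 1) = rowSum f r + f r := by
  simp [rowSum, Finset.sum_range_succ]

lemma rowSum_le {f g : ℕ → ℕ} (h : ∀ i, f i ≤ g i) (r : ℕ) : rowSum f r ≤ rowSum g r :=
  Finset.sum_le_sum fun i _ => h i

lemma rowSum_congr {f g : ℕ → ℕ} {r : ℕ} (h : ∀ i < r, f i = g i) : rowSum f r = rowSum g r :=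
  Finset.sum_congr rfl fun i hi => h i (Finset.mem_range.1 hi)

/-- A semistandard tableau of shape `lam/alpha` with entries in `{1, …, n}`, encoded by the
chain of shapes `L k` formed by `alpha` and the cells with entry at most `k`. -/
structure StripChain (n : ℕ) (lam alpha : ℕ → ℕ) (L : ℕ → ℕ → ℕ) : Prop where
  bot : L 0 = alpha
  top : ∀ k, n ≤ k → L k = lam
  le_succ : ∀ k r, L k r ≤ L (k + 1) r
  strip : ∀ k r, L (k + 1) (r + 1) ≤ L k r

/-- In the rows up to `r`, the letter `j + 2` occurs at most as often as the letter `j + 1` in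
the rows before `r`. -/
def LatticeAt (L : ℕ → ℕ → ℕ) (r j : ℕ) : Prop :=
  rowSum (L (j + 2)) (r + 1) + rowSum (L j) r ≤ rowSum (L (j + 1)) r + rowSum (L (j + 1)) (r + 1)

/-- In the first `R` rows, the letter `k + 1` occurs `N k` times. -/
def HasContent (R : ℕ) (N : ℕ → ℕ) (L : ℕ → ℕ → ℕ) : Prop :=
  ∀ k, rowSum (L (k + 1)) R = rowSum (L k) R + N k

/-- The Littlewood–Richardson tableaux of shape `lam/alpha` and content `N`, as chains. -/
def lrChains (n : ℕ) (lam alpha : ℕ → ℕ) (R : ℕ) (N : ℕ → ℕ) : Set (ℕ → ℕ → ℕ) :=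
  {L | StripChain n lam alpha L ∧ (∀ r j, LatticeAt L r j) ∧ HasContent R N L}

namespace StripChain

variable {n : ℕ} {lam alpha : ℕ → ℕ} {L : ℕ → ℕ → ℕ}

lemma mono (h : StripChain n lam alpha L) (r : ℕ) : Monotone fun k => L k r :=
  monotone_nat_of_le_succ fun k => h.le_succ k r

lemma le_lam (h : StripChain n lam alpha L) (k r : ℕ) : L k r ≤ lam r := by
  have : L k r ≤ L (max k n) r := h.mono r (le_max_left k n)
  rwa [h.top _ (le_max_right k n)] at this

lemma alpha_le (h : StripChain n lam alpha L) (k r : ℕ) : alpha r ≤ L k r := by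
  have : L 0 r ≤ L k r := h.mono r (Nat.zero_le k)
  rwa [h.bot] at this

lemma anti (h : StripChain n lam alpha L) (k : ℕ) : Antitone (L k) :=
  antitone_nat_of_succ_le fun r => (h.le_succ k (r + 1)).trans (h.strip k r)

lemma lam_anti (h : StripChain n lam alpha L) : Antitone lam := by
  have := h.anti n
  rwa [h.top n le_rfl] at this

lemma eq_zero (h : StripChain n lam alpha L) {R : ℕ} (hR : lam R = 0) (k : ℕ) {r : ℕ}
    (hr : R ≤ r) : L k r = 0 := by
  have h1 := h.le_lam k r
  have h2 := h.lam_anti hr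
  omega

lemma rowSum_eq (h : StripChain n lam alpha L) {R : ℕ} (hR : lam R = 0) (k : ℕ) {r : ℕ}
    (hr : R ≤ r) : rowSum (L k) r = rowSum (L k) R := by
  induction r, hr using Nat.le_induction with
  | base => rfl
  | succ r hr ih => rw [rowSum_succ, ih, h.eq_zero hR k hr, add_zero]

end StripChain

lemma finite_stripChain (n : ℕ) (lam alpha : ℕ → ℕ) {R : ℕ} (hR : lam R = 0) :
    {L | StripChain n lam alpha L}.Finite := by
  let F : (ℕ → ℕ → ℕ) → (Fin n → Fin R → Fin (lam 0 + 1)) := fun L k r =>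
    ⟨min (L k r) (lam 0), by omega⟩
  refine Set.Finite.of_finite_image (f := F) (Set.toFinite _) ?_
  intro L hL L' hL' hF
  have hL : StripChain n lam alpha L := hL
  have hL' : StripChain n lam alpha L' := hL'
  funext k r
  by_cases hk : n ≤ k
  · rw [hL.top k hk, hL'.top k hk]
  by_cases hr : R ≤ r
  · rw [hL.eq_zero hR k hr, hL'.eq_zero hR k hr]
  have := congrArg Fin.val (congrFun (congrFun hF ⟨k, by omega⟩) ⟨r, by omega⟩)
  simp only [F] at this
  have h1 := hL.le_lam k r
  have h2 := hL'.le_lam k r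
  have h3 := hL.lam_anti (Nat.zero_le r)
  omega

lemma finite_lrChains (n : ℕ) (lam alpha : ℕ → ℕ) {R : ℕ} (hR : lam R = 0) (N : ℕ → ℕ) :
    (lrChains n lam alpha R N).Finite :=
  (finite_stripChain n lam alpha hR).subset fun _ h => h.1

/-- The signed indicator of `v` being in the dotted Weyl group orbit of `N`. -/
def dotSign (n : ℕ) (N : ℕ → ℕ) (v : ℕ → ℤ) : ℤ :=
  Matrix.det (Matrix.of fun i j : Fin n =>
    if v i - (i : ℕ) = (N j : ℤ) - (j : ℕ) then (1 : ℤ) else 0)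

lemma dotSign_swap {n : ℕ} (N : ℕ → ℕ) {v w : ℕ → ℤ} {j : ℕ} (hj : j + 1 < n)
    (h0 : w j = v (j + 1) - 1) (h1 : w (j + 1) = v j + 1)
    (h2 : ∀ i, i ≠ j → i ≠ j + 1 → w i = v i) : dotSign n N w = - dotSign n N v := by
  let a : Fin n := ⟨j, by omega⟩
  let b : Fin n := ⟨j + 1, hj⟩
  have hab : a ≠ b := by simp [a, b]
  have := Matrix.det_permute (Equiv.swap a b)
    (Matrix.of fun i j : Fin n => if v i - (i : ℕ) = (N j : ℤ) - (j : ℕ) then (1 : ℤ) else 0)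
  rw [Equiv.Perm.sign_swap hab] at this
  unfold dotSign
  simp only [Units.val_neg, Units.val_one, Int.cast_neg, Int.cast_one, neg_mul, one_mul] at this
  rw [← this]
  congr 1
  ext i k
  simp only [Matrix.of_apply, Matrix.submatrix_apply, id]
  by_cases hia : i = a
  · subst hia
    rw [Equiv.swap_apply_left]
    simp only [a, b, h0]
    congr 1
    push_cast
    apply propext
    constructor <;> intro h <;> linarith
  by_cases hib : i = b
  · subst hib
    rw [Equiv.swap_apply_right]
    simp only [a, b, h1]
    congr 1
    push_cast
    apply propext
    constructor <;> intro h <;> linarith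
  rw [Equiv.swap_apply_of_ne_of_ne hia hib, h2]
  · intro h; exact hia (Fin.ext h)
  · intro h; exact hib (Fin.ext h)

open Classical in
lemma dotSign_of_antitone (n : ℕ) {N : ℕ → ℕ} {v : ℕ → ℤ} (hN : Antitone N) (hv : Antitone v) :
    dotSign n N v = if ∀ i < n, v i = N i then 1 else 0 := by
  have hV : StrictAnti fun i : Fin n => v i - (i : ℕ) := by
    intro i j hij
    have := hv (le_of_lt (show (i : ℕ) < j from hij))
    have : ((i : ℕ) : ℤ) < (j : ℕ) := by exact_mod_cast hij
    simp only
    omega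
  have hM : StrictAnti fun i : Fin n => (N i : ℤ) - (i : ℕ) := by
    intro i j hij
    have : (N j : ℤ) ≤ N i := by exact_mod_cast hN (le_of_lt (show (i : ℕ) < j from hij))
    have : ((i : ℕ) : ℤ) < (j : ℕ) := by exact_mod_cast hij
    simp only
    omega
  split_ifs with h
  · unfold dotSign
    convert Matrix.det_one (n := Fin n) (R := ℤ)
    ext i j
    simp only [Matrix.of_apply, Matrix.one_apply]
    congr 1
    rw [h i i.2]
    apply propext
    exact hM.injective.eq_iff
  · by_cases hall : ∀ i : Fin n, ∃ j : Fin n, v i - (i : ℕ) = (N j : ℤ) - (j : ℕ)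
    · exfalso
      apply h
      have hsub : Finset.univ.image (fun i : Fin n => v i - (i : ℕ)) ⊆
          Finset.univ.image (fun i : Fin n => (N i : ℤ) - (i : ℕ)) := by
        intro x hx
        obtain ⟨i, -, rfl⟩ := Finset.mem_image.1 hx
        obtain ⟨j, hj⟩ := hall i
        exact Finset.mem_image.2 ⟨j, Finset.mem_univ _, hj.symm⟩
      have heq := Finset.eq_of_subset_of_card_le hsub (by
        rw [Finset.card_image_of_injective _ hM.injective,
          Finset.card_image_of_injective _ hV.injective])
      have hr : Set.range (fun i : Fin n => v i - (i : ℕ)) =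
          Set.range (fun i : Fin n => (N i : ℤ) - (i : ℕ)) := by
        have := congrArg (fun s : Finset ℤ => (s : Set ℤ)) heq
        simpa using this
      have hfun : (fun i : Fin n => -(v i - (i : ℕ))) =
          fun i : Fin n => -((N i : ℤ) - (i : ℕ)) := by
        have h1 : StrictMono fun i : Fin n => -(v i - (i : ℕ)) := fun _ _ hij => neg_lt_neg (hV hij)
        have h2 : StrictMono fun i : Fin n => -((N i : ℤ) - (i : ℕ)) :=
          fun _ _ hij => neg_lt_neg (hM hij)
        refine (h1.range_inj h2).1 ?_
        have h3 := congrArg (fun s : Set ℤ => Neg.neg '' s) hr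
        simp only [← Set.range_comp] at h3
        exact h3
      intro i hi
      have := congrFun hfun ⟨i, hi⟩
      simp only at this
      linarith
    · push Not at hall
      obtain ⟨i, hi⟩ := hall
      exact Matrix.det_eq_zero_of_row_eq_zero i fun j => by simp [hi j]

/-- `(r, j)` is the first place where the lattice condition fails: the row `r` is minimal and, in
this row, `j` is maximal. -/
structure FirstViolation (L : ℕ → ℕ → ℕ) (r j : ℕ) : Prop where
  not_latticeAt : ¬ LatticeAt L r j
  above : ∀ r' < r, ∀ j', LatticeAt L r' j'
  right : ∀ j', j < j' → LatticeAt L r j'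

lemma FirstViolation.unique {L : ℕ → ℕ → ℕ} {r j r' j' : ℕ} (h : FirstViolation L r j)
    (h' : FirstViolation L r' j') : r = r' ∧ j = j' := by
  have hr : r = r' := by
    rcases lt_trichotomy r r' with hlt | heq | hlt
    · exact absurd (h'.above r hlt j) h.not_latticeAt
    · exact heq
    · exact absurd (h.above r' hlt j') h'.not_latticeAt
  subst hr
  refine ⟨rfl, ?_⟩
  rcases lt_trichotomy j j' with hlt | heq | hlt
  · exact absurd (h.right j' hlt) h'.not_latticeAt
  · exact heq
  · exact absurd (h'.right j hlt) h.not_latticeAt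

/-- The excess of the letters `j + 1` over the letters `j + 2` in the first `r` rows, plus one. -/
def latticeGap (L : ℕ → ℕ → ℕ) (r j : ℕ) : ℕ :=
  2 * rowSum (L (j + 1)) r + 1 - rowSum (L j) r - rowSum (L (j + 2)) r

/-- The row `j + 1` of the toggled chain. -/
def toggleRow (L : ℕ → ℕ → ℕ) (r₀ j r : ℕ) : ℕ :=
  if r < r₀ then L (j + 1) r
  else max (L j r) (L (j + 2) (r + 1)) +
    (if r = r₀ then L (j + 2) r₀ - latticeGap L r₀ j else min (L (j + 2) r) (L j (r - 1))) -
    L (j + 1) r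

/-- The Bender–Knuth toggle of the letters `j + 1` and `j + 2` in the rows from `r₀` on. -/
def toggle (L : ℕ → ℕ → ℕ) (r₀ j : ℕ) : ℕ → ℕ → ℕ :=
  Function.update L (j + 1) (toggleRow L r₀ j)

section toggle

variable {n : ℕ} {lam alpha : ℕ → ℕ} {L : ℕ → ℕ → ℕ} {r₀ j : ℕ}

lemma toggle_self (L : ℕ → ℕ → ℕ) (r₀ j : ℕ) : toggle L r₀ j (j + 1) = toggleRow L r₀ j :=
  Function.update_self ..

lemma toggle_of_ne (L : ℕ → ℕ → ℕ) (r₀ : ℕ) {j k : ℕ} (hk : k ≠ j + 1) :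
    toggle L r₀ j k = L k :=
  Function.update_of_ne hk ..

lemma toggle_of_lt (L : ℕ → ℕ → ℕ) (j k : ℕ) {r₀ r : ℕ} (hr : r < r₀) :
    toggle L r₀ j k r = L k r := by
  by_cases hk : k = j + 1
  · subst hk
    rw [toggle_self, toggleRow, if_pos hr]
  · rw [toggle_of_ne L r₀ hk]

lemma rowSum_toggle (L : ℕ → ℕ → ℕ) (j k : ℕ) {r₀ r : ℕ} (hr : r ≤ r₀) :
    rowSum (toggle L r₀ j k) r = rowSum (L k) r :=
  rowSum_congr fun _ hi => toggle_of_lt L j k (by omega)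

lemma latticeGap_toggle (L : ℕ → ℕ → ℕ) (r₀ j : ℕ) :
    latticeGap (toggle L r₀ j) r₀ j = latticeGap L r₀ j := by
  simp only [latticeGap, rowSum_toggle L j _ le_rfl]

lemma FirstViolation.gap (hv : FirstViolation L r₀ j) (h : StripChain n lam alpha L) :
    latticeGap L r₀ j + rowSum (L j) r₀ + rowSum (L (j + 2)) r₀ = 2 * rowSum (L (j + 1)) r₀ + 1 ∧
    1 ≤ latticeGap L r₀ j ∧
    L (j + 1) r₀ + latticeGap L r₀ j ≤ L (j + 2) r₀ ∧
    (1 ≤ r₀ → L (j + 2) r₀ ≤ latticeGap L r₀ j + L j (r₀ - 1)) := by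
  have h0 := hv.not_latticeAt
  simp only [LatticeAt, rowSum_succ] at h0
  rcases Nat.eq_zero_or_pos r₀ with hr | hr
  · subst hr
    simp [latticeGap] at h0 ⊢
    omega
  · obtain ⟨r, rfl⟩ : ∃ r, r₀ = r + 1 := ⟨r₀ - 1, by omega⟩
    have h1 := hv.above r (by omega) j
    have h2 := h.strip (j + 1) r
    have h3 := h.le_succ j r
    simp only [LatticeAt, latticeGap, rowSum_succ, Nat.add_sub_cancel] at *
    simp only [show j + 1 + 1 = j + 2 from rfl] at *
    omega

lemma FirstViolation.bounds (hv : FirstViolation L r₀ j) (h : StripChain n lam alpha L) (r : ℕ) :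
    L j r ≤ toggleRow L r₀ j r ∧ toggleRow L r₀ j r ≤ L (j + 2) r ∧
    L (j + 2) (r + 1) ≤ toggleRow L r₀ j r ∧ toggleRow L r₀ j (r + 1) ≤ L j r := by
  obtain ⟨-, -, h3, h4⟩ := hv.gap h
  have a1 := h.le_succ j r
  have a2 := h.le_succ (j + 1) r
  have a3 := h.strip (j + 1) r
  have a4 := h.strip j r
  have b1 := h.le_succ j (r + 1)
  have b2 := h.le_succ (j + 1) (r + 1)
  have b3 := h.strip (j + 1) (r + 1)
  have c : 1 ≤ r → L (j + 1) r ≤ L j (r - 1) := fun hr => by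
    have := h.strip j (r - 1)
    rwa [Nat.sub_add_cancel hr] at this
  simp only [show j + 1 + 1 = j + 2 from rfl] at *
  unfold toggleRow
  rw [Nat.add_sub_cancel]
  rcases eq_or_ne r r₀ with rfl | p
  · split_ifs <;> omega
  rcases eq_or_ne (r + 1) r₀ with rfl | q
  · simp only [Nat.add_sub_cancel] at *
    split_ifs <;> omega
  · split_ifs <;> omega

lemma FirstViolation.lt_of_eq_zero (hv : FirstViolation L r₀ j) (h : StripChain n lam alpha L)
    {R : ℕ} (hR : lam R = 0) : r₀ < R := by
  obtain ⟨-, h2, h3, -⟩ := hv.gap h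
  by_contra hlt
  have := h.eq_zero hR (j + 2) (not_lt.1 hlt)
  omega

lemma FirstViolation.succ_lt (hv : FirstViolation L r₀ j) (h : StripChain n lam alpha L) :
    j + 1 < n := by
  obtain ⟨-, h2, h3, -⟩ := hv.gap h
  by_contra hlt
  rw [h.top (j + 1) (by omega), h.top (j + 2) (by omega)] at h3
  omega

lemma FirstViolation.stripChain_toggle (hv : FirstViolation L r₀ j)
    (h : StripChain n lam alpha L) : StripChain n lam alpha (toggle L r₀ j) where
  bot := by rw [toggle_of_ne L r₀ (by omega), h.bot]
  top k hk := by
    have := hv.succ_lt h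
    rw [toggle_of_ne L r₀ (by omega), h.top k hk]
  le_succ k r := by
    obtain ⟨b1, b2, b3, b4⟩ := hv.bounds h r
    rcases eq_or_ne k j with rfl | hk
    · rw [toggle_self, toggle_of_ne L r₀ (by omega)]
      exact b1
    rcases eq_or_ne k (j + 1) with rfl | hk'
    · rw [toggle_self, toggle_of_ne L r₀ (by omega)]
      exact b2
    rw [toggle_of_ne L r₀ hk', toggle_of_ne L r₀ (by omega)]
    exact h.le_succ k r
  strip k r := by
    obtain ⟨b1, b2, b3, b4⟩ := hv.bounds h r
    rcases eq_or_ne k j with rfl | hk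
    · rw [toggle_self, toggle_of_ne L r₀ (by omega)]
      exact b4
    rcases eq_or_ne k (j + 1) with rfl | hk'
    · rw [toggle_self, toggle_of_ne L r₀ (by omega)]
      exact b3
    rw [toggle_of_ne L r₀ hk', toggle_of_ne L r₀ (by omega)]
    exact h.strip k r

lemma FirstViolation.toggle (hv : FirstViolation L r₀ j) (h : StripChain n lam alpha L) :
    FirstViolation (toggle L r₀ j) r₀ j where
  not_latticeAt := by
    obtain ⟨g1, g2, g3, g4⟩ := hv.gap h
    have a1 := h.le_succ j r₀
    have a3 := h.strip (j + 1) r₀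
    simp only [show j + 1 + 1 = j + 2 from rfl] at *
    simp only [LatticeAt, rowSum_succ, rowSum_toggle L j _ le_rfl]
    rw [toggle_self, toggle_of_ne L r₀ (by omega), toggleRow, if_neg (by omega), if_pos rfl]
    omega
  above r hr j' := by
    have := hv.above r hr j'
    simpa only [LatticeAt, rowSum_toggle L j _ (show r ≤ r₀ by omega),
      rowSum_toggle L j _ (show r + 1 ≤ r₀ by omega)] using this
  right j' hj' := by
    have := hv.right j' hj'
    simp only [LatticeAt] at *
    rwa [rowSum_toggle L j _ le_rfl, rowSum_toggle L j _ le_rfl,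
      toggle_of_ne L r₀ (show j' + 2 ≠ j + 1 by omega),
      toggle_of_ne L r₀ (show j' + 1 ≠ j + 1 by omega)]

lemma FirstViolation.toggle_toggle (hv : FirstViolation L r₀ j) (h : StripChain n lam alpha L) :
    _root_.toggle (_root_.toggle L r₀ j) r₀ j = L := by
  funext k r
  by_cases hk : k = j + 1
  swap
  · rw [toggle_of_ne _ r₀ hk, toggle_of_ne _ r₀ hk]
  subst hk
  by_cases hr : r < r₀
  · rw [toggle_of_lt _ _ _ hr, toggle_of_lt _ _ _ hr]
  rw [toggle_self, toggleRow, if_neg hr, latticeGap_toggle, toggle_self,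
    toggle_of_ne L r₀ (show j ≠ j + 1 by omega), toggle_of_ne L r₀ (show j + 2 ≠ j + 1 by omega),
    toggleRow, if_neg hr]
  obtain ⟨-, -, h3, h4⟩ := hv.gap h
  have a1 := h.le_succ j r
  have a2 := h.le_succ (j + 1) r
  have a3 := h.strip (j + 1) r
  have c : 1 ≤ r → L (j + 1) r ≤ L j (r - 1) := fun hr => by
    have := h.strip j (r - 1)
    rwa [Nat.sub_add_cancel hr] at this
  simp only [show j + 1 + 1 = j + 2 from rfl] at *
  split_ifs with p
  · subst p
    omega
  · omega

lemma FirstViolation.rowSum_toggleRow (hv : FirstViolation L r₀ j)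
    (h : StripChain n lam alpha L) {R : ℕ} (hR : r₀ + 1 ≤ R) :
    rowSum (toggleRow L r₀ j) R + rowSum (L (j + 1)) R + 1 + min (L (j + 2) R) (L j (R - 1)) =
      rowSum (L j) R + rowSum (L (j + 2)) (R + 1) := by
  obtain ⟨g1, g2, g3, g4⟩ := hv.gap h
  induction R, hR using Nat.le_induction with
  | base =>
    have a1 := h.le_succ j r₀
    have a3 := h.strip (j + 1) r₀
    have e : rowSum (toggleRow L r₀ j) r₀ = rowSum (L (j + 1)) r₀ := by
      rw [← toggle_self, rowSum_toggle L j _ le_rfl]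
    simp only [show j + 1 + 1 = j + 2 from rfl] at *
    simp only [rowSum_succ, e, Nat.add_sub_cancel]
    rw [toggleRow, if_neg (by omega), if_pos rfl]
    omega
  | succ R hR ih =>
    have a1 := h.le_succ j R
    have a2 := h.le_succ (j + 1) R
    have a3 := h.strip (j + 1) R
    have c : L (j + 1) R ≤ L j (R - 1) := by
      have := h.strip j (R - 1)
      rwa [Nat.sub_add_cancel (by omega)] at this
    simp only [show j + 1 + 1 = j + 2 from rfl] at *
    simp only [rowSum_succ, Nat.add_sub_cancel] at *
    rw [toggleRow, if_neg (by omega), if_neg (by omega)]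
    omega

end toggle

lemma exists_firstViolation {n : ℕ} {lam alpha : ℕ → ℕ} {L : ℕ → ℕ → ℕ}
    (h : StripChain n lam alpha L) (hL : ¬ ∀ r j, LatticeAt L r j) :
    ∃ r j, FirstViolation L r j := by
  classical
  push Not at hL
  let r := Nat.find hL
  have hr : ∃ j, ¬ LatticeAt L r j := Nat.find_spec hL
  have habove : ∀ r' < r, ∀ j', LatticeAt L r' j' := fun r' hr' j' => by
    by_contra hc
    exact Nat.find_min hL hr' ⟨j', hc⟩
  have htriv : ∀ j, n ≤ j → LatticeAt L r j := fun j hj => by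
    simp only [LatticeAt, h.top j hj, h.top (j + 1) (by omega), h.top (j + 2) (by omega)]
    omega
  obtain ⟨j, hj⟩ := hr
  have hjn : j ≤ n := by
    by_contra hc
    exact hj (htriv j (by omega))
  let P : ℕ → Prop := fun j => ¬ LatticeAt L r j
  refine ⟨r, Nat.findGreatest P n, Nat.findGreatest_spec (P := P) hjn hj, habove, ?_⟩
  intro j' hj'
  by_cases hn : j' ≤ n
  · by_contra hc
    exact Nat.findGreatest_is_greatest hj' hn hc
  · exact htriv j' (by omega)

/-- The multiplicities of the letters in the first `R` rows. -/
def weight (R : ℕ) (L : ℕ → ℕ → ℕ) (k : ℕ) : ℤ :=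
  (rowSum (L (k + 1)) R : ℤ) - rowSum (L k) R

section stembridge

variable {n : ℕ} {lam alpha : ℕ → ℕ} {L : ℕ → ℕ → ℕ} {R : ℕ}

lemma FirstViolation.dotSign_toggle {r₀ j : ℕ} (hv : FirstViolation L r₀ j)
    (h : StripChain n lam alpha L) (hR : lam R = 0) (N : ℕ → ℕ) :
    dotSign n N (weight R (_root_.toggle L r₀ j)) = - dotSign n N (weight R L) := by
  have hw := hv.rowSum_toggleRow h (hv.lt_of_eq_zero h hR)
  rw [rowSum_succ, h.eq_zero hR (j + 2) le_rfl, Nat.zero_min] at hw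
  refine dotSign_swap N (hv.succ_lt h) ?_ ?_ fun i hi hi' => ?_
  · simp only [weight, toggle_self, toggle_of_ne L r₀ (show j ≠ j + 1 by omega)]
    simp only [show j + 1 + 1 = j + 2 from rfl] at *
    omega
  · simp only [weight, toggle_self, toggle_of_ne L r₀ (show j + 1 + 1 ≠ j + 1 by omega)]
    simp only [show j + 1 + 1 = j + 2 from rfl] at *
    omega
  · simp only [weight, toggle_of_ne L r₀ hi', toggle_of_ne L r₀ (show i + 1 ≠ j + 1 by omega)]

lemma antitone_weight (h : StripChain n lam alpha L) (hR : lam R = 0)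
    (hL : ∀ r j, LatticeAt L r j) : Antitone (weight R L) := by
  refine antitone_nat_of_succ_le fun k => ?_
  have := hL R k
  simp only [LatticeAt, rowSum_succ, h.eq_zero hR _ le_rfl] at this
  simp only [weight, show k + 1 + 1 = k + 2 from rfl]
  omega

lemma hasContent_iff (h : StripChain n lam alpha L) {N : ℕ → ℕ} (hN : ∀ k, n ≤ k → N k = 0) :
    HasContent R N L ↔ ∀ k < n, weight R L k = N k := by
  constructor
  · intro hc k _
    have := hc k
    simp only [weight]
    omega
  · intro hc k
    by_cases hk : k < n
    · have := hc k hk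
      simp only [weight] at this
      omega
    · rw [h.top k (by omega), h.top (k + 1) (by omega), hN k (by omega), add_zero]

theorem ncard_lrChains (n : ℕ) (lam alpha : ℕ → ℕ) {R : ℕ} (hR : lam R = 0) {N : ℕ → ℕ}
    (hN : Antitone N) (hN0 : ∀ k, n ≤ k → N k = 0) :
    ((lrChains n lam alpha R N).ncard : ℤ) =
      ∑ L ∈ (finite_stripChain n lam alpha hR).toFinset, dotSign n N (weight R L) := by
  classical
  set F := (finite_stripChain n lam alpha hR).toFinset with hF
  have mem : ∀ L, L ∈ F ↔ StripChain n lam alpha L := fun L => by simp [hF]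
  rw [← Finset.sum_filter_add_sum_filter_not F (fun L => ∀ r j, LatticeAt L r j)]
  have h1 : ∑ L ∈ F with ∀ r j, LatticeAt L r j, dotSign n N (weight R L) =
      ((lrChains n lam alpha R N).ncard : ℤ) := by
    have : lrChains n lam alpha R N =
        ((F.filter fun L => ∀ r j, LatticeAt L r j).filter fun L => HasContent R N L :
          Finset (ℕ → ℕ → ℕ)) := by
      ext L
      simp [lrChains, mem, and_assoc]
    rw [this, Set.ncard_coe_finset, Finset.card_filter, Nat.cast_sum]
    refine Finset.sum_congr rfl fun L hL => ?_
    rw [Finset.mem_filter, mem] at hL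
    rw [dotSign_of_antitone n hN (antitone_weight hL.1 hR hL.2), hasContent_iff hL.1 hN0]
    split_ifs <;> simp
  have h2 : ∑ L ∈ F with ¬ ∀ r j, LatticeAt L r j, dotSign n N (weight R L) = 0 := by
    have key : ∀ L ∈ F.filter fun L => ¬ ∀ r j, LatticeAt L r j,
        ∃ p : ℕ × ℕ, StripChain n lam alpha L ∧ FirstViolation L p.1 p.2 := by
      intro L hL
      rw [Finset.mem_filter, mem] at hL
      obtain ⟨r, j, hv⟩ := exists_firstViolation hL.1 hL.2
      exact ⟨(r, j), hL.1, hv⟩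
    choose p hp using key
    have hmem : ∀ L hL, toggle L (p L hL).1 (p L hL).2 ∈
        F.filter fun L => ¬ ∀ r j, LatticeAt L r j := by
      intro L hL
      obtain ⟨h, hv⟩ := hp L hL
      rw [Finset.mem_filter, mem]
      exact ⟨hv.stripChain_toggle h, fun hc => (hv.toggle h).not_latticeAt (hc _ _)⟩
    refine Finset.sum_involution (fun L hL => toggle L (p L hL).1 (p L hL).2) ?_ ?_ hmem ?_
    · intro L hL
      obtain ⟨h, hv⟩ := hp L hL
      rw [hv.dotSign_toggle h hR]
      ring
    · intro L hL hne heq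
      obtain ⟨h, hv⟩ := hp L hL
      have := hv.dotSign_toggle h hR N
      rw [heq] at this
      omega
    · intro L hL
      obtain ⟨h, hv⟩ := hp L hL
      obtain ⟨e1, e2⟩ := (hp _ (hmem L hL)).2.unique (hv.toggle h)
      simp only [e1, e2]
      exact hv.toggle_toggle h
  rw [h1, h2, add_zero]

end stembridge

/-- Move the `q` rows below the row `m` on top of the first `m` rows, shifted to the right by
`W`. -/
def rot (m q W : ℕ) (f : ℕ → ℕ) (r : ℕ) : ℕ :=
  if r < q then f (m + r) + W else if r < q + m then f (r - q) else 0

/-- The inverse of `rot`. -/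
def unrot (m q W : ℕ) (f : ℕ → ℕ) (r : ℕ) : ℕ :=
  if r < m then f (q + r) else if r < m + q then f (r - m) - W else 0

section rot

variable {n m q W : ℕ} {lam alpha : ℕ → ℕ} {L : ℕ → ℕ → ℕ}

lemma rowSum_add (f : ℕ → ℕ) (a b : ℕ) :
    rowSum f (a + b) = rowSum f a + rowSum (fun i => f (a + i)) b := by
  simp only [rowSum, Finset.sum_range_add]

lemma rowSum_rot (m q W : ℕ) (f : ℕ → ℕ) :
    rowSum (rot m q W f) (q + m) = rowSum f (m + q) + q * W := by
  rw [rowSum_add, rowSum_add f m q]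
  have h1 : rowSum (rot m q W f) q = rowSum (fun i => f (m + i)) q + q * W := by
    rw [rowSum_congr (g := fun i => f (m + i) + W) fun i hi => by rw [rot, if_pos hi]]
    simp [rowSum, Finset.sum_add_distrib]
  have h2 : rowSum (fun i => rot m q W f (q + i)) m = rowSum f m :=
    rowSum_congr fun i hi => by
      simp only [rot]
      rw [if_neg (by omega), if_pos (by omega), Nat.add_sub_cancel_left]
  omega

lemma unrot_rot {f : ℕ → ℕ} (hf : ∀ r, m + q ≤ r → f r = 0) :
    unrot m q W (rot m q W f) = f := by
  funext r
  simp only [unrot, rot]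
  split_ifs with h1 h2 h3 h4 h5 h6
  all_goals first
    | omega
    | (congr 1; omega)
    | (rw [Nat.add_sub_cancel]; congr 1; omega)
    | exact (hf r (by omega)).symm

lemma rot_unrot {f : ℕ → ℕ} (hf : ∀ r, m + q ≤ r → f r = 0) (hW : ∀ r < q, W ≤ f r) :
    rot m q W (unrot m q W f) = f := by
  funext r
  simp only [unrot, rot]
  split_ifs with h1 h2 h3 h4 h5 h6
  all_goals first
    | omega
    | (congr 1; omega)
    | (rw [Nat.add_sub_cancel_left, Nat.sub_add_cancel (hW r h1)])
    | exact (hf r (by omega)).symm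

lemma StripChain.rot (h : StripChain n lam alpha L) (hW : lam 0 ≤ W) :
    StripChain n (rot m q W lam) (rot m q W alpha) fun k => rot m q W (L k) where
  bot := by rw [h.bot]
  top k hk := by rw [h.top k hk]
  le_succ k r := by
    have h1 := h.le_succ k (m + r)
    have h2 := h.le_succ k (r - q)
    simp only [_root_.rot]
    split_ifs <;> omega
  strip k r := by
    have h1 := h.strip k (m + r)
    have h2 := h.strip k (r - q)
    have h3 := h.le_lam (k + 1) 0
    simp only [_root_.rot]
    split_ifs with h4 h5 h6 h7 h8
    all_goals try omega
    · rw [← add_assoc]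
      omega
    · rw [show r + 1 - q = 0 by omega]
      omega
    · rwa [show r + 1 - q = r - q + 1 by omega]

lemma StripChain.unrot (h : StripChain n (_root_.rot m q W lam) (_root_.rot m q W alpha) L)
    (hlam : ∀ r, m + q ≤ r → lam r = 0) (halpha : ∀ r, m ≤ r → alpha r = 0)
    (hm : lam m ≤ alpha (m - 1)) :
    StripChain n lam alpha fun k => unrot m q W (L k) where
  bot := by
    rw [h.bot, unrot_rot fun r hr => halpha r (by omega)]
  top k hk := by rw [h.top k hk, unrot_rot hlam]
  le_succ k r := by
    have h1 := h.le_succ k (q + r)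
    have h2 := h.le_succ k (r - m)
    simp only [_root_.unrot]
    split_ifs <;> omega
  strip k r := by
    have h1 := h.strip k (q + r)
    have h2 := h.strip k (r - m)
    simp only [_root_.unrot]
    split_ifs with h4 h5 h6 h7 h8
    all_goals try omega
    · have h6 := h.le_lam (k + 1) 0
      have h7 := h.alpha_le k (q + r)
      simp only [_root_.rot] at h6 h7
      rw [if_pos (by omega)] at h6
      rw [if_neg (by omega), if_pos (by omega)] at h7
      rw [show q + r - q = m - 1 by omega] at h7
      rw [show r + 1 - m = 0 by omega]
      rw [add_zero] at h6
      omega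
    · rw [show r + 1 - m = r - m + 1 by omega]
      omega

theorem ncard_lrChains_rot {N : ℕ → ℕ} (hN : Antitone N) (hN0 : ∀ k, n ≤ k → N k = 0)
    (hlam : ∀ r, m + q ≤ r → lam r = 0) (halpha : ∀ r, m ≤ r → alpha r = 0)
    (hm : lam m ≤ alpha (m - 1)) (hW : lam 0 ≤ W) :
    (lrChains n lam alpha (m + q) N).ncard =
      (lrChains n (rot m q W lam) (rot m q W alpha) (q + m) N).ncard := by
  have hR : rot m q W lam (q + m) = 0 := by
    simp only [rot]
    rw [if_neg (by omega), if_neg (by omega)]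
  have hz : ∀ r, m + q ≤ r → rot m q W lam r = 0 := fun r hr => by
    simp only [rot]
    rw [if_neg (by omega), if_neg (by omega)]
  rw [← Nat.cast_inj (R := ℤ), ncard_lrChains n lam alpha (hlam _ le_rfl) hN hN0,
    ncard_lrChains n _ _ hR hN hN0]
  refine Finset.sum_nbij' (fun L k => rot m q W (L k)) (fun L k => unrot m q W (L k)) ?_ ?_ ?_ ?_ ?_
  · intro L hL
    simp only [Set.Finite.mem_toFinset, Set.mem_ofPred_eq] at hL ⊢
    exact hL.rot hW
  · intro L hL
    simp only [Set.Finite.mem_toFinset, Set.mem_ofPred_eq] at hL ⊢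
    exact hL.unrot hlam halpha hm
  · intro L hL
    simp only [Set.Finite.mem_toFinset, Set.mem_ofPred_eq] at hL
    funext k
    refine unrot_rot fun r hr => ?_
    have := hL.le_lam k r
    rw [hlam r hr] at this
    omega
  · intro L hL
    simp only [Set.Finite.mem_toFinset, Set.mem_ofPred_eq] at hL
    funext k
    refine rot_unrot (fun r hr => ?_) fun r hr => ?_
    · have := hL.le_lam k r
      rw [hz r hr] at this
      omega
    · have := hL.alpha_le k r
      simp only [rot, if_pos hr] at this
      omega
  · intro L hL
    congr 1
    funext k
    simp only [weight, rowSum_rot]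
    push_cast
    ring

end rot

lemma lam_le_content {n R m : ℕ} {lam alpha N : ℕ → ℕ} {L : ℕ → ℕ → ℕ}
    (hL : L ∈ lrChains n lam alpha R N) (hm : alpha m = 0) (hR : m + 1 ≤ R) : lam m ≤ N 0 := by
  obtain ⟨h, hlat, hc⟩ := hL
  have key : ∀ j, rowSum (L (j + 1)) (m + 1) ≤ rowSum (L j) m + N 0 := by
    intro j
    induction j with
    | zero =>
      obtain ⟨d, rfl⟩ := Nat.exists_eq_add_of_le hR
      have h1 := hc 0
      rw [rowSum_add _ (m + 1) d, rowSum_add (L 0) (m + 1) d] at h1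
      have h2 := rowSum_le (fun i => h.le_succ 0 (m + 1 + i)) d
      have h3 : L 0 m = 0 := by rw [h.bot, hm]
      rw [rowSum_succ (L 0), h3] at h1
      omega
    | succ j ih =>
      have := hlat m j
      simp only [LatticeAt] at this
      rw [show j + 1 + 1 = j + 2 from rfl]
      omega
  have := key n
  rw [h.top n le_rfl, h.top (n + 1) (by omega), rowSum_succ] at this
  omega

/-- Decrease the value at `i` by one. -/
def decr (f : ℕ → ℕ) (i r : ℕ) : ℕ := if r = i then f r - 1 else f r

lemma rowSum_decr {f : ℕ → ℕ} {i : ℕ} (hf : 1 ≤ f i) (r : ℕ) :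
    rowSum (decr f i) r + (if i < r then 1 else 0) = rowSum f r := by
  induction r with
  | zero => simp
  | succ r ih =>
    rw [rowSum_succ, rowSum_succ, ← ih]
    have : decr f i r + (if r = i then 1 else 0) = f r := by
      unfold decr
      split_ifs with h
      · subst h
        omega
      · rfl
    split_ifs at * <;> omega

lemma exists_last_argmin (f : ℕ → ℕ) {a R : ℕ} (hconst : ∀ r, R ≤ r → f r = f R)
    (h : ∃ r, a ≤ r ∧ f r < f R) :
    ∃ ρ, a ≤ ρ ∧ ρ < R ∧ (∀ r, a ≤ r → f ρ ≤ f r) ∧ ∀ r, ρ < r → f ρ < f r := by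
  classical
  have hex : ∃ v r, a ≤ r ∧ f r = v := ⟨f a, a, le_rfl, rfl⟩
  obtain ⟨r₁, hr₁, hv⟩ := Nat.find_spec hex
  set v := Nat.find hex with hv_def
  have hmin : ∀ r, a ≤ r → v ≤ f r := fun r hr => Nat.find_min' hex ⟨r, hr, rfl⟩
  have hlt : ∀ r, a ≤ r → f r = v → r < R := by
    intro r hr hrv
    by_contra hc
    obtain ⟨r', hr', hlt⟩ := h
    have h1 := hconst r (by omega)
    have h2 := hmin r' hr'
    omega
  let P : ℕ → Prop := fun r => a ≤ r ∧ f r = v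
  obtain ⟨h1, h2⟩ : P (Nat.findGreatest P R) :=
    Nat.findGreatest_spec (P := P) (hlt r₁ hr₁ hv).le ⟨hr₁, hv⟩
  refine ⟨_, h1, hlt _ h1 h2, fun r hr => h2.trans_le (hmin r hr), fun r hr => ?_⟩
  rw [h2]
  refine lt_of_le_of_ne (hmin r (by omega)) fun heq => ?_
  have hP : P r := ⟨by omega, heq.symm⟩
  exact Nat.findGreatest_is_greatest hr (hlt r hP.1 hP.2).le hP

/-- The number of letters `1` in the rows before `r` minus the number of letters `2` in the rows
up to `r`. -/
def slack (L : ℕ → ℕ → ℕ) (r : ℕ) : ℕ :=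
  rowSum (L 1) r + rowSum (L 1) (r + 1) - rowSum (L 0) r - rowSum (L 2) (r + 1)

lemma slack_add {L : ℕ → ℕ → ℕ} {r : ℕ} (h : LatticeAt L r 0) :
    slack L r + rowSum (L 0) r + rowSum (L 2) (r + 1) =
      rowSum (L 1) r + rowSum (L 1) (r + 1) := by
  simp only [LatticeAt, slack, Nat.zero_add] at *
  omega

/-- Move a letter `2` into the skew diagram: the row `p` of the inner shape shrinks by one cell
and, in the row `ρ`, the shape of the entries at most `1` shrinks by one cell. -/
def shift (L : ℕ → ℕ → ℕ) (p ρ k : ℕ) : ℕ → ℕ :=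
  if k = 0 then decr (L 0) p else if k = 1 then decr (L 1) ρ else L k

/-- The assumptions on a skew shape `lam/a` and a content `N` under which a letter `2` can be
inserted while removing a box of the row `p` of `a`. -/
structure ShiftHyp (p s : ℕ) (lam a N : ℕ → ℕ) : Prop where
  one_le_p : 1 ≤ p
  one_le_s : 1 ≤ s
  lam_eq : lam (p + s + 1) = 0
  a_eq : a (p - 1) = a p
  a_pos : 1 ≤ a p
  a_drop : a (p + 1) + s ≤ a p
  content_zero : s + 2 ≤ N 0
  content_one : N 1 = s
  content_pos : N (s + 1) ≠ 0

/-- The conditions on the row `ρ` that determine the insertion. -/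
structure IsShiftRow (L : ℕ → ℕ → ℕ) (p ρ : ℕ) : Prop where
  le : p ≤ ρ
  of_eq : ρ = p → L 2 (p + 1) + 1 ≤ L 0 p ∧ ∀ r, p + 1 ≤ r → 1 ≤ slack L r
  before : p < ρ → ∀ r, p + 1 ≤ r → slack L ρ ≤ slack L r
  after : p < ρ → ∀ r, ρ < r → slack L ρ < slack L r
  below : p < ρ → L 1 (p + 1) = L 0 p → ρ = p + 1

section shift

variable {n p s ρ : ℕ} {lam a N N' : ℕ → ℕ} {L : ℕ → ℕ → ℕ}

lemma ShiftHyp.row_eq (H : ShiftHyp p s lam a N) (h : StripChain n lam a L) : L 1 p = L 0 p := by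
  have h1 := h.strip 0 (p - 1)
  rw [Nat.sub_add_cancel H.one_le_p, h.bot, H.a_eq] at h1
  have h2 := h.alpha_le 1 p
  simp only [Nat.zero_add] at h1
  rw [h.bot]
  omega

lemma ShiftHyp.exists_two (H : ShiftHyp p s lam a N)
    (hL : L ∈ lrChains n lam a (p + s + 1) N) :
    rowSum (L 1) (p + 1) < rowSum (L 2) (p + 1) := by
  obtain ⟨h, hlat, hc⟩ := hL
  by_contra hcon
  have key : ∀ i, rowSum (L (i + 2)) (p + 1 + i) ≤ rowSum (L (i + 1)) (p + 1 + i) := by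
    intro i
    induction i with
    | zero => simpa using hcon
    | succ i ih =>
      have := hlat (p + 1 + i) (i + 1)
      simp only [LatticeAt, show i + 1 + 2 = i + 3 from rfl, show i + 1 + 1 = i + 2 from rfl,
        ← add_assoc] at *
      omega
  have h1 := key s
  have h2 := hc (s + 1)
  have h3 := H.content_pos
  rw [show p + 1 + s = p + s + 1 by omega] at h1
  rw [show s + 1 + 1 = s + 2 from rfl] at h2
  omega

lemma ShiftHyp.exists_isShiftRow (H : ShiftHyp p s lam a N)
    (hL : L ∈ lrChains n lam a (p + s + 1) N) : ∃ ρ ≤ p + s, IsShiftRow L p ρ := by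
  have htwo := H.exists_two hL
  obtain ⟨h, hlat, hc⟩ := hL
  have hs := H.one_le_s
  have hrow := H.row_eq h
  have hE := fun r => slack_add (hlat r 0)
  have c0 := hc 0
  have c1 := hc 1
  have n0 := H.content_zero
  have n1 := H.content_one
  have hdrop : L 0 (p + 1) + s ≤ L 0 p := by
    rw [h.bot]
    exact H.a_drop
  have m1 := h.le_succ 0 (p + 1)
  have m2 := h.le_succ 1 (p + 1)
  have m3 := h.strip 1 p
  simp only [Nat.zero_add, show 1 + 1 = 2 from rfl] at *
  have hcontent : ∀ r, rowSum (L 1) r ≤ rowSum (L 0) r + N 0 ∧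
      rowSum (L 2) r ≤ rowSum (L 1) r + N 1 := by
    intro r
    by_cases hr : p + s + 1 ≤ r
    · rw [h.rowSum_eq H.lam_eq 0 hr, h.rowSum_eq H.lam_eq 1 hr, h.rowSum_eq H.lam_eq 2 hr]
      omega
    · obtain ⟨d, hd⟩ := Nat.exists_eq_add_of_le (not_le.1 hr).le
      have h2 := rowSum_le (fun i => h.le_succ 0 (r + i)) d
      have h3 := rowSum_le (fun i => h.le_succ 1 (r + i)) d
      rw [hd, rowSum_add, rowSum_add] at c0 c1
      simp only [Nat.zero_add, show 1 + 1 = 2 from rfl] at *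
      omega
  have hconst : ∀ r, p + s + 1 ≤ r → slack L r = slack L (p + s + 1) := by
    intro r hr
    simp only [slack]
    rw [h.rowSum_eq H.lam_eq 0 hr, h.rowSum_eq H.lam_eq 1 hr,
      h.rowSum_eq H.lam_eq 1 (show p + s + 1 ≤ r + 1 by omega),
      h.rowSum_eq H.lam_eq 2 (show p + s + 1 ≤ r + 1 by omega),
      h.rowSum_eq H.lam_eq 1 (show p + s + 1 ≤ p + s + 1 + 1 by omega),
      h.rowSum_eq H.lam_eq 2 (show p + s + 1 ≤ p + s + 1 + 1 by omega)]
  have hER : slack L (p + s + 1) + s = N 0 := by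
    have := hE (p + s + 1)
    rw [h.rowSum_eq H.lam_eq 1 (show p + s + 1 ≤ p + s + 1 + 1 by omega),
      h.rowSum_eq H.lam_eq 2 (show p + s + 1 ≤ p + s + 1 + 1 by omega)] at this
    omega
  by_cases hfull : L 1 (p + 1) = L 0 p
  · have hafter : ∀ r, p + 1 < r → slack L (p + 1) < slack L r := by
      intro r hr
      have e1 := hE r
      have e2 := hE (p + 1)
      have e3 := (hcontent (r + 1)).2
      obtain ⟨d, rfl⟩ := Nat.exists_eq_add_of_le (show p + 1 + 1 ≤ r by omega)
      have h2 := rowSum_le (fun i => h.le_succ 0 (p + 1 + 1 + i)) d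
      rw [rowSum_add (L 0), rowSum_add (L 1) (p + 1 + 1) d] at e1
      simp only [rowSum_succ, Nat.zero_add] at *
      omega
    refine ⟨p + 1, by omega, by omega, by omega, fun _ r hr => ?_, fun _ => hafter, by omega⟩
    rcases Nat.eq_or_lt_of_le hr with rfl | hr
    · exact le_rfl
    · exact (hafter r hr).le
  by_cases hP : L 2 (p + 1) + 1 ≤ L 0 p ∧ ∀ r, p + 1 ≤ r → 1 ≤ slack L r
  · exact ⟨p, by omega, le_rfl, fun _ => hP, by omega, by omega, by omega⟩
  obtain ⟨ρ, h1, h2, h3, h4⟩ : ∃ ρ, p + 1 ≤ ρ ∧ ρ < p + s + 1 ∧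
      (∀ r, p + 1 ≤ r → slack L ρ ≤ slack L r) ∧ ∀ r, ρ < r → slack L ρ < slack L r := by
    refine exists_last_argmin _ hconst ?_
    by_cases hz : ∀ r, p + 1 ≤ r → 1 ≤ slack L r
    · have hfull2 : L 2 (p + 1) = L 0 p := by
        by_contra hne
        exact hP ⟨by omega, hz⟩
      refine ⟨p + 1, le_rfl, ?_⟩
      have e1 := hE (p + 1)
      have e2 := (hcontent (p + 1 + 1)).1
      simp only [rowSum_succ] at *
      omega
    · push Not at hz
      obtain ⟨r, hr, hr0⟩ := hz
      exact ⟨r, hr, by omega⟩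
  exact ⟨ρ, by omega, by omega, by omega, fun _ => h3, fun _ => h4, fun _ h => absurd h hfull⟩

lemma shift_zero (L : ℕ → ℕ → ℕ) (p ρ : ℕ) : shift L p ρ 0 = decr (L 0) p := rfl

lemma shift_one (L : ℕ → ℕ → ℕ) (p ρ : ℕ) : shift L p ρ 1 = decr (L 1) ρ := rfl

lemma shift_of_two_le (L : ℕ → ℕ → ℕ) (p ρ : ℕ) {k : ℕ} (hk : 2 ≤ k) : shift L p ρ k = L k := by
  rw [shift, if_neg (by omega), if_neg (by omega)]

lemma IsShiftRow.props (hρ : IsShiftRow L p ρ) (H : ShiftHyp p s lam a N)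
    (hL : L ∈ lrChains n lam a (p + s + 1) N) :
    1 ≤ L 0 p ∧ 1 ≤ L 1 ρ ∧ L 2 (ρ + 1) + 1 ≤ L 1 ρ ∧ (p < ρ → L 0 ρ + 1 ≤ L 1 ρ) := by
  obtain ⟨h, hlat, hc⟩ := hL
  have hrow := H.row_eq h
  have hpos : 1 ≤ L 0 p := by
    rw [h.bot]
    exact H.a_pos
  rcases hρ.le.eq_or_lt with rfl | hlt
  · have := (hρ.of_eq rfl).1
    omega
  · have e1 := slack_add (hlat ρ 0)
    have e2 := slack_add (hlat (ρ + 1) 0)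
    have e3 := hρ.after hlt (ρ + 1) (by omega)
    have e4 := h.strip 0 ρ
    have e5 := h.le_succ 1 (ρ + 1)
    simp only [rowSum_succ, Nat.zero_add, show 1 + 1 = 2 from rfl] at *
    omega

lemma slack_shift (hρ : IsShiftRow L p ρ) (H : ShiftHyp p s lam a N)
    (hL : L ∈ lrChains n lam a (p + s + 1) N) (r : ℕ) :
    rowSum (shift L p ρ 1) r + rowSum (shift L p ρ 1) (r + 1) + (if ρ < r then 1 else 0)
        + (if ρ < r + 1 then 1 else 0) =
      slack L r + (if p < r then 1 else 0) + rowSum (shift L p ρ 0) r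
        + rowSum (shift L p ρ 2) (r + 1) := by
  obtain ⟨h1, h2, -, -⟩ := hρ.props H hL
  have e := slack_add (hL.2.1 r 0)
  have e0 := rowSum_decr h1 r
  have e1 := rowSum_decr h2 r
  have e2 := rowSum_decr h2 (r + 1)
  rw [shift_zero, shift_one, shift_of_two_le L p ρ le_rfl]
  omega

lemma IsShiftRow.shift_mem (hρ : IsShiftRow L p ρ) (hρs : ρ ≤ p + s) (H : ShiftHyp p s lam a N)
    (hN0 : N' 0 = N 0) (hN1 : N' 1 = N 1 + 1) (hN2 : ∀ k, 2 ≤ k → N' k = N k)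
    (hL : L ∈ lrChains n lam a (p + s + 1) N) :
    shift L p ρ ∈ lrChains n lam (decr a p) (p + s + 1) N' := by
  obtain ⟨q1, q2, q3, q4⟩ := hρ.props H hL
  have hsl := slack_shift hρ H hL
  obtain ⟨h, hlat, hc⟩ := hL
  have hrow := H.row_eq h
  have hle := hρ.le
  refine ⟨⟨?_, ?_, ?_, ?_⟩, ?_, ?_⟩
  · rw [shift_zero, h.bot]
  · intro k hk
    have hn : 2 ≤ n := by
      by_contra hn
      have h1 := hc 1
      rw [h.top 1 (by omega), h.top (1 + 1) (by omega), H.content_one] at h1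
      have := H.one_le_s
      omega
    rw [shift_of_two_le L p ρ (by omega), h.top k hk]
  · intro k r
    have h1 := h.le_succ k r
    rcases k with _ | _ | k
    · rw [shift_zero, Nat.zero_add, shift_one]
      unfold decr
      rw [Nat.zero_add] at h1
      split_ifs with c1 c2 c2
      · omega
      · omega
      · subst c2
        exact Nat.le_sub_one_of_lt (q4 (by omega))
      · omega
    · rw [Nat.zero_add, shift_one, shift_of_two_le L p ρ (by omega)]
      unfold decr
      rw [Nat.zero_add] at h1
      split_ifs <;> omega
    · rwa [shift_of_two_le L p ρ (by omega), shift_of_two_le L p ρ (by omega)]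
  · intro k r
    have h1 := h.strip k r
    rcases k with _ | _ | k
    · rw [shift_zero, Nat.zero_add, shift_one]
      unfold decr
      rw [Nat.zero_add] at h1
      by_cases hr : r = p
      · subst hr
        rw [if_pos rfl]
        have h2 := h.le_succ 1 (r + 1)
        rw [show 1 + 1 = 2 from rfl] at h2
        rcases hle.eq_or_lt with heq | hlt
        · have := (hρ.of_eq heq.symm).1
          split_ifs <;> omega
        · have := hρ.below hlt
          split_ifs <;> omega
      · rw [if_neg hr]
        split_ifs <;> omega
    · rw [Nat.zero_add, shift_one, shift_of_two_le L p ρ (by omega)]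
      unfold decr
      rw [Nat.zero_add] at h1
      split_ifs with c
      · subst c
        exact Nat.le_sub_one_of_lt q3
      · exact h1
    · rwa [shift_of_two_le L p ρ (by omega), shift_of_two_le L p ρ (by omega)]
  · intro r j
    have h1 := hlat r j
    simp only [LatticeAt] at *
    rcases j with _ | _ | j
    · have e := hsl r
      simp only [Nat.zero_add] at *
      rcases hle.eq_or_lt with heq | hlt
      · subst heq
        have hs := (hρ.of_eq rfl).2
        split_ifs at e with c1 c2
        · have := hs r c1
          omega
        · omega
        · have : r = p := by omega
          subst this
          have s1 := slack_add (hlat r 0)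
          have s2 := slack_add (hlat (r + 1) 0)
          have s3 := hs (r + 1) le_rfl
          have s4 := h.strip 0 r
          have s5 := h.le_succ 1 (r + 1)
          simp only [rowSum_succ, Nat.zero_add, show 1 + 1 = 2 from rfl] at *
          omega
        · omega
      · have := hρ.after hlt r
        split_ifs at e <;> omega
    · have e1 := rowSum_decr q2 r
      simp only [Nat.zero_add] at *
      rw [shift_of_two_le L p ρ (show 2 ≤ 1 + 2 by omega),
        shift_of_two_le L p ρ (show 2 ≤ 1 + 1 by omega), shift_one]
      omega
    · rwa [shift_of_two_le L p ρ (by omega), shift_of_two_le L p ρ (by omega),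
        shift_of_two_le L p ρ (by omega)]
  · intro k
    have h1 := hc k
    have e0 := rowSum_decr q1 (p + s + 1)
    have e1 := rowSum_decr q2 (p + s + 1)
    rw [if_pos (by omega)] at e0 e1
    rcases k with _ | _ | k
    · rw [shift_zero, Nat.zero_add, shift_one, hN0]
      rw [Nat.zero_add] at h1
      omega
    · rw [Nat.zero_add, shift_one, shift_of_two_le L p ρ (by omega), hN1]
      rw [Nat.zero_add] at h1
      omega
    · rw [shift_of_two_le L p ρ (by omega), shift_of_two_le L p ρ (by omega), hN2 _ (by omega)]
      exact h1

lemma decr_injective {f g : ℕ → ℕ} {i : ℕ} (hf : 1 ≤ f i) (hg : 1 ≤ g i)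
    (h : decr f i = decr g i) : f = g := by
  funext r
  have := congrFun h r
  unfold decr at this
  split_ifs at this with c
  · subst c
    omega
  · exact this

lemma IsShiftRow.unique {L₁ L₂ : ℕ → ℕ → ℕ} {ρ₁ ρ₂ : ℕ} (h₁ : IsShiftRow L₁ p ρ₁)
    (h₂ : IsShiftRow L₂ p ρ₂) (H : ShiftHyp p s lam a N)
    (hL₁ : L₁ ∈ lrChains n lam a (p + s + 1) N) (hL₂ : L₂ ∈ lrChains n lam a (p + s + 1) N)
    (heq : shift L₁ p ρ₁ = shift L₂ p ρ₂) : ¬ ρ₁ < ρ₂ := by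
  intro hlt
  rcases h₁.le.eq_or_lt with hp | hp
  · have e0 := congrFun (congrFun heq 0) p
    have e1 := congrFun (congrFun heq 1) p
    have r1 := H.row_eq hL₁.1
    have r2 := H.row_eq hL₂.1
    have p1 := (h₁.props H hL₁).1
    have p2 := (h₂.props H hL₂).1
    simp only [shift_zero, shift_one, decr, if_pos] at e0 e1
    rw [if_pos hp, if_neg (by omega)] at e1
    omega
  · have a1 := slack_shift h₁ H hL₁ ρ₁
    have a2 := slack_shift h₁ H hL₁ ρ₂
    have b1 := slack_shift h₂ H hL₂ ρ₁
    have b2 := slack_shift h₂ H hL₂ ρ₂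
    rw [heq] at a1 a2
    have c1 := h₁.after hp ρ₂ hlt
    have c2 := h₂.before (by omega) ρ₁ hp
    rw [if_neg (by omega), if_pos (by omega), if_pos (by omega)] at a1
    rw [if_pos (by omega), if_pos (by omega), if_pos (by omega)] at a2
    rw [if_neg (by omega), if_neg (by omega), if_pos (by omega)] at b1
    rw [if_neg (by omega), if_pos (by omega), if_pos (by omega)] at b2
    omega

theorem ShiftHyp.ncard_le (H : ShiftHyp p s lam a N)
    (hN0 : N' 0 = N 0) (hN1 : N' 1 = N 1 + 1) (hN2 : ∀ k, 2 ≤ k → N' k = N k) :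
    (lrChains n lam a (p + s + 1) N).ncard ≤
      (lrChains n lam (decr a p) (p + s + 1) N').ncard := by
  classical
  have key : ∀ L, ∃ ρ, L ∈ lrChains n lam a (p + s + 1) N → ρ ≤ p + s ∧ IsShiftRow L p ρ := by
    intro L
    by_cases hL : L ∈ lrChains n lam a (p + s + 1) N
    · obtain ⟨ρ, h⟩ := H.exists_isShiftRow hL
      exact ⟨ρ, fun _ => h⟩
    · exact ⟨0, fun h => absurd h hL⟩
  choose ρ hρ using key
  refine Set.ncard_le_ncard_of_injOn (fun L => shift L p (ρ L)) (fun L hL => ?_) ?_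
    (finite_lrChains n lam _ H.lam_eq N')
  · exact (hρ L hL).2.shift_mem (hρ L hL).1 H hN0 hN1 hN2 hL
  · intro L₁ hL₁ L₂ hL₂ heq
    have h₁ := (hρ L₁ hL₁).2
    have h₂ := (hρ L₂ hL₂).2
    have hlt := h₁.unique h₂ H hL₁ hL₂ heq
    have hgt := h₂.unique h₁ H hL₂ hL₁ heq.symm
    have hr : ρ L₁ = ρ L₂ := by omega
    obtain ⟨p1, p2, -, -⟩ := h₁.props H hL₁
    obtain ⟨p3, p4, -, -⟩ := h₂.props H hL₂
    simp only [hr] at heq p2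
    funext k
    have hk := congrFun heq k
    rcases k with _ | _ | k
    · exact decr_injective p1 p3 hk
    · exact decr_injective p2 p4 hk
    · rwa [shift_of_two_le _ _ _ (by omega), shift_of_two_le _ _ _ (by omega)] at hk

end shift

/-- The shape `L k` consists of `alpha` and the cells of `lam/alpha` whose entry in `e` is at most
`k`. -/
structure Encodes (lam alpha : ℕ → ℕ) (e : ℕ → ℕ → ℕ) (L : ℕ → ℕ → ℕ) : Prop where
  alpha_le : ∀ k r, alpha r ≤ L k r
  le_lam : ∀ k r, L k r ≤ lam r
  le_iff : ∀ k r c, inShape lam alpha r c → (e r c ≤ k ↔ c < L k r)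

section tableaux

variable {n R : ℕ} {lam alpha beta : ℕ → ℕ} {e : ℕ → ℕ → ℕ} {L : ℕ → ℕ → ℕ}

lemma card_cells {lo hi : ℕ → ℕ} (h : ∀ i, lo i ≤ hi i) (R : ℕ) :
    Nat.card {p : ℕ × ℕ // p.1 < R ∧ lo p.1 ≤ p.2 ∧ p.2 < hi p.1} + rowSum lo R =
      rowSum hi R := by
  let S : Finset (Σ _ : ℕ, ℕ) := (Finset.range R).sigma fun i => Finset.Ico (lo i) (hi i)
  have e : {p : ℕ × ℕ // p.1 < R ∧ lo p.1 ≤ p.2 ∧ p.2 < hi p.1} ≃ S :=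
    (Equiv.sigmaEquivProd ℕ ℕ).symm.subtypeEquiv fun p => by
      simp [S, Equiv.sigmaEquivProd]
  rw [Nat.card_congr e, Nat.card_eq_fintype_card, Fintype.card_coe, Finset.card_sigma]
  simp only [Nat.card_Ico]
  unfold rowSum
  rw [← Finset.sum_add_distrib]
  exact Finset.sum_congr rfl fun i _ => Nat.sub_add_cancel (h i)

namespace Encodes

lemma le_succ (h : Encodes lam alpha e L) (k r : ℕ) : L k r ≤ L (k + 1) r := by
  by_contra hc
  have h1 := h.alpha_le (k + 1) r
  have h2 := h.le_lam k r
  have hs : inShape lam alpha r (L (k + 1) r) := ⟨h1, by omega⟩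
  have h3 := (h.le_iff k r _ hs).2 (by omega)
  have h4 := (h.le_iff (k + 1) r _ hs).1 (by omega)
  omega

lemma eq_succ_iff (h : Encodes lam alpha e L) (k r c : ℕ) :
    (inShape lam alpha r c ∧ e r c = k + 1) ↔ L k r ≤ c ∧ c < L (k + 1) r := by
  have h1 := h.alpha_le k r
  have h2 := h.le_lam (k + 1) r
  constructor
  · rintro ⟨hs, he⟩
    have h3 := h.le_iff k r c hs
    have h4 := h.le_iff (k + 1) r c hs
    omega
  · rintro ⟨h3, h4⟩
    have hs : inShape lam alpha r c := ⟨by omega, by omega⟩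
    have h5 := h.le_iff k r c hs
    have h6 := h.le_iff (k + 1) r c hs
    exact ⟨hs, by omega⟩

lemma unique {L' : ℕ → ℕ → ℕ} (h : Encodes lam alpha e L) (h' : Encodes lam alpha e L') :
    L = L' := by
  have aux : ∀ {L L' : ℕ → ℕ → ℕ}, Encodes lam alpha e L → Encodes lam alpha e L' →
      ∀ k r, L k r ≤ L' k r := by
    intro L L' h h' k r
    by_contra hc
    have h1 := h'.alpha_le k r
    have h2 := h.le_lam k r
    have hs : inShape lam alpha r (L' k r) := ⟨h1, by omega⟩
    have h3 := (h.le_iff k r _ hs).2 (by omega)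
    have h4 := (h'.le_iff k r _ hs).1 h3
    omega
  funext k r
  exact le_antisymm (aux h h' k r) (aux h' h k r)

lemma card_content (h : Encodes lam alpha e L) (hlam : ∀ r, R ≤ r → lam r = 0) (k : ℕ) :
    Nat.card {p : ℕ × ℕ // inShape lam alpha p.1 p.2 ∧ e p.1 p.2 = k + 1} + rowSum (L k) R =
      rowSum (L (k + 1)) R := by
  rw [← card_cells (h.le_succ k) R]
  congr 1
  refine Nat.card_congr (Equiv.subtypeEquivRight fun p => ?_)
  rw [h.eq_succ_iff]
  refine ⟨fun hp => ⟨?_, hp⟩, fun hp => hp.2⟩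
  by_contra hc
  have h1 := hlam p.1 (by omega)
  have h2 := h.le_lam (k + 1) p.1
  omega

lemma card_prefix (h : Encodes lam alpha e L) (r c k : ℕ) :
    Nat.card {p : ℕ × ℕ // inShape lam alpha p.1 p.2 ∧
        (p.1 < r ∨ (p.1 = r ∧ c ≤ p.2)) ∧ e p.1 p.2 = k + 1} + rowSum (L k) r + max c (L k r) =
      rowSum (L (k + 1)) r + max c (L (k + 1) r) := by
  let g : ℕ → ℕ → ℕ := fun k i => if i = r then max c (L k r) else L k i
  have hg : ∀ k, rowSum (g k) (r + 1) = rowSum (L k) r + max c (L k r) := by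
    intro k
    rw [rowSum_succ, rowSum_congr (g := L k) fun i hi => if_neg (by omega)]
    simp [g]
  have hle : ∀ i, g k i ≤ g (k + 1) i := by
    intro i
    have h1 := h.le_succ k r
    have h2 := h.le_succ k i
    simp only [g]
    split_ifs <;> omega
  rw [← hg (k + 1), ← card_cells hle (r + 1), hg k, ← add_assoc]
  congr 2
  refine Nat.card_congr (Equiv.subtypeEquivRight fun p => ?_)
  have := h.eq_succ_iff k p.1 p.2
  simp only [g]
  rw [show (inShape lam alpha p.1 p.2 ∧ (p.1 < r ∨ (p.1 = r ∧ c ≤ p.2)) ∧ e p.1 p.2 = k + 1) ↔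
    ((p.1 < r ∨ (p.1 = r ∧ c ≤ p.2)) ∧ (inShape lam alpha p.1 p.2 ∧ e p.1 p.2 = k + 1)) by tauto,
    this]
  split_ifs with hp
  · rw [hp]
    omega
  · omega

end Encodes

open Classical in
lemma LRTableau.exists_encodes (hsub : ∀ i, alpha i ≤ lam i) (T : LRTableau lam alpha beta) :
    ∃ L, Encodes lam alpha T.entry L := by
  have hex : ∀ k r, ∃ c, alpha r ≤ c ∧ (lam r ≤ c ∨ k < T.entry r c) := fun k r =>
    ⟨lam r, hsub r, Or.inl le_rfl⟩
  refine ⟨fun k r => Nat.find (hex k r), fun k r => (Nat.find_spec (hex k r)).1,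
    fun k r => Nat.find_min' _ ⟨hsub r, Or.inl le_rfl⟩,
    fun k r c hs => ⟨fun he => ?_, fun hc => ?_⟩⟩
  · by_contra hlt
    obtain ⟨h1, h2⟩ := Nat.find_spec (hex k r)
    set c₀ := Nat.find (hex k r)
    have hs₀ : inShape lam alpha r c₀ := ⟨h1, by have := hs.2; omega⟩
    have h3 := T.row_weak r c₀ c (by omega) hs₀ hs
    have h4 := hs₀.2
    omega
  · have h1 := Nat.find_min (hex k r) hc
    have h2 := hs.1
    by_contra he
    exact h1 ⟨h2, Or.inr (by omega)⟩

lemma LRTableau.mem_lrChains (halpha : Antitone alpha) (hlam : Antitone lam)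
    (hR : lam R = 0) (hbeta : ∀ k, n ≤ k → beta k = 0) (T : LRTableau lam alpha beta)
    (h : Encodes lam alpha T.entry L) : L ∈ lrChains n lam alpha R beta := by
  have hz : ∀ r, R ≤ r → lam r = 0 := fun r hr => by
    have := hlam hr
    omega
  have hc : HasContent R beta L := fun k => by
    have h1 := h.card_content hz k
    rw [T.content k] at h1
    omega
  refine ⟨⟨?_, ?_, h.le_succ, ?_⟩, ?_, hc⟩
  · funext r
    by_contra hne
    have h1 := h.alpha_le 0 r
    have h2 := h.le_lam 0 r
    have hs : inShape lam alpha r (alpha r) := ⟨le_rfl, by omega⟩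
    have h3 := (h.le_iff 0 r _ hs).2 (by omega)
    have h4 := T.one_le r _ hs
    omega
  · intro k hk
    funext r
    by_contra hne
    have h1 := h.alpha_le k r
    have h2 := h.le_lam k r
    have hs : inShape lam alpha r (L k r) := ⟨h1, by omega⟩
    have h3 := (h.le_iff k r _ hs).not.2 (by omega)
    obtain ⟨k', hk'⟩ : ∃ k', T.entry r (L k r) = k' + 1 := ⟨T.entry r (L k r) - 1, by omega⟩
    have h4 := (h.eq_succ_iff k' r (L k r)).1 ⟨hs, hk'⟩
    have h5 := hc k'
    rw [hbeta k' (by omega)] at h5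
    have hrR : r < R := by
      by_contra hcon
      have := hz r (by omega)
      omega
    have h6 : rowSum (L k') R < rowSum (L (k' + 1)) R :=
      Finset.sum_lt_sum (fun i _ => h.le_succ k' i) ⟨r, Finset.mem_range.2 hrR, by omega⟩
    omega
  · intro k r
    by_contra hcon
    have h1 := h.alpha_le k r
    have h2 := h.le_lam (k + 1) (r + 1)
    have h3 := halpha (Nat.le_succ r)
    have h4 := hlam (Nat.le_succ r)
    simp only [Nat.succ_eq_add_one] at *
    have hs : inShape lam alpha r (L k r) := ⟨h1, by omega⟩
    have hs' : inShape lam alpha (r + 1) (L k r) := ⟨by omega, by omega⟩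
    have h5 := h.le_iff k r _ hs
    have h6 := h.le_iff (k + 1) (r + 1) _ hs'
    have h7 := T.col_strict r (r + 1) _ (Nat.lt_succ_self r) hs hs'
    omega
  · intro r j
    induction r with
    | zero =>
      by_cases hlt : L (j + 1) 0 < L (j + 2) 0
      · have hs : inShape lam alpha 0 (L (j + 1) 0) :=
          ⟨h.alpha_le _ _, hlt.trans_le (h.le_lam _ _)⟩
        have h1 := T.lattice _ _ j hs
        have h2 := h.card_prefix 0 (L (j + 1) 0) j
        have h3 := h.card_prefix 0 (L (j + 1) 0) (j + 1)
        have h4 := h.le_succ j 0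
        simp only [LatticeAt, rowSum_succ, show j + 1 + 1 = j + 2 from rfl] at *
        omega
      · simp only [LatticeAt, rowSum_succ, rowSum_zero]
        omega
    | succ r ih =>
      by_cases hlt : L (j + 1) (r + 1) < L (j + 2) (r + 1)
      · have hs : inShape lam alpha (r + 1) (L (j + 1) (r + 1)) :=
          ⟨h.alpha_le _ _, hlt.trans_le (h.le_lam _ _)⟩
        have h1 := T.lattice _ _ j hs
        have h2 := h.card_prefix (r + 1) (L (j + 1) (r + 1)) j
        have h3 := h.card_prefix (r + 1) (L (j + 1) (r + 1)) (j + 1)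
        have h4 := h.le_succ j (r + 1)
        simp only [LatticeAt, rowSum_succ, show j + 1 + 1 = j + 2 from rfl] at *
        omega
      · have h1 := h.le_succ j r
        simp only [LatticeAt, rowSum_succ] at *
        omega

open Classical in
lemma exists_tableau (hR : lam R = 0) (hL : L ∈ lrChains n lam alpha R beta) :
    ∃ T : LRTableau lam alpha beta, Encodes lam alpha T.entry L := by
  obtain ⟨h, hlat, hc⟩ := hL
  have hex : ∀ r c, inShape lam alpha r c → ∃ k, c < L k r := fun r c hs =>
    ⟨n, by rw [h.top n le_rfl]; exact hs.2⟩
  let e : ℕ → ℕ → ℕ := fun r c =>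
    if hs : inShape lam alpha r c then Nat.find (hex r c hs) else 0
  have hE : Encodes lam alpha e L := by
    refine ⟨h.alpha_le, h.le_lam, fun k r c hs => ?_⟩
    simp only [e, dif_pos hs, Nat.find_le_iff]
    exact ⟨fun ⟨k', hk', hlt⟩ => hlt.trans_le (h.mono r hk'), fun hlt => ⟨k, le_rfl, hlt⟩⟩
  have hz : ∀ r, R ≤ r → lam r = 0 := fun r hr => by
    have := h.lam_anti hr
    omega
  refine ⟨⟨e, fun r c hs => dif_neg hs, fun r c hs => ?_, fun r c₁ c₂ hcc hs₁ hs₂ => ?_,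
    fun r₁ r₂ c hr hs₁ hs₂ => ?_, fun k => ?_, fun r c k hs => ?_⟩, hE⟩
  · have h1 := hE.le_iff 0 r c hs
    rw [h.bot] at h1
    have := hs.1
    omega
  · rw [hE.le_iff _ r c₁ hs₁]
    have := (hE.le_iff (e r c₂) r c₂ hs₂).1 le_rfl
    omega
  · have h1 := (hE.le_iff (e r₂ c) r₂ c hs₂).1 le_rfl
    rcases hk : e r₂ c with _ | k
    · rw [hk, h.bot] at h1
      have := hs₂.1
      omega
    · rw [hk] at h1
      have h2 := h.anti (k + 1) (show r₁ + 1 ≤ r₂ from hr)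
      have h3 := h.strip k r₁
      have := (hE.le_iff k r₁ c hs₁).2 (by omega)
      omega
  · have h1 := hE.card_content hz k
    have h2 := hc k
    omega
  · have h1 := hE.card_prefix r c k
    have h2 := hE.card_prefix r c (k + 1)
    have h3 := hlat r k
    have h4 := h.le_succ k r
    have h5 := h.le_succ (k + 1) r
    simp only [LatticeAt, rowSum_succ, show k + 1 + 1 = k + 2 from rfl] at *
    omega

lemma LRTableau.ext_of_encodes {T T' : LRTableau lam alpha beta}
    (h : Encodes lam alpha T.entry L) (h' : Encodes lam alpha T'.entry L) : T = T' := by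
  have : T.entry = T'.entry := by
    funext r c
    by_cases hs : inShape lam alpha r c
    · have h1 := h.le_iff (T.entry r c) r c hs
      have h2 := h'.le_iff (T.entry r c) r c hs
      have h3 := h.le_iff (T'.entry r c) r c hs
      have h4 := h'.le_iff (T'.entry r c) r c hs
      omega
    · rw [T.zero_outside r c hs, T'.zero_outside r c hs]
  cases T
  cases T'
  simpa using this

theorem card_lrTableau (halpha : Antitone alpha) (hlam : Antitone lam)
    (hsub : ∀ i, alpha i ≤ lam i) (hR : lam R = 0) (hbeta : ∀ k, n ≤ k → beta k = 0) :
    Nat.card (LRTableau lam alpha beta) = (lrChains n lam alpha R beta).ncard := by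
  choose F hF using fun T : LRTableau lam alpha beta => T.exists_encodes hsub
  rw [← Nat.card_coe_set_eq]
  refine Nat.card_eq_of_bijective
    (fun T => (⟨F T, T.mem_lrChains halpha hlam hR hbeta (hF T)⟩ : lrChains n lam alpha R beta))
    ⟨fun T T' heq => ?_, fun L => ?_⟩
  · have h1 : F T = F T' := congrArg Subtype.val heq
    exact LRTableau.ext_of_encodes (hF T) (h1 ▸ hF T')
  · obtain ⟨T, hT⟩ := exists_tableau hR L.2
    exact ⟨T, Subtype.ext ((hF T).unique hT)⟩

end tableaux

lemma IsPartition.lt_iff_lt_conjP {f : ℕ → ℕ} (hf : IsPartition f) (k i : ℕ) :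
    k < f i ↔ i < conjP f k := by
  classical
  obtain ⟨hanti, M, hM⟩ := hf
  have hex : ∃ c, f c ≤ k := ⟨M, by omega⟩
  have hiff : ∀ i, k < f i ↔ i < Nat.find hex := by
    intro i
    rw [Nat.lt_find_iff]
    refine ⟨fun h j hj => ?_, fun h => ?_⟩
    · have := hanti hj
      omega
    · have := h i le_rfl
      omega
  have hcard : conjP f k = Nat.find hex := by
    unfold conjP
    rw [Nat.card_congr (Equiv.subtypeEquivRight hiff), Nat.card_congr Fin.equivSubtype.symm,
      Nat.card_fin]
  rw [hcard]
  exact hiff i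

lemma IsPartition.antitone_conjP {f : ℕ → ℕ} (hf : IsPartition f) : Antitone (conjP f) := by
  refine antitone_nat_of_succ_le fun k => ?_
  by_contra hc
  have h1 := hf.lt_iff_lt_conjP k (conjP f k)
  have h2 := hf.lt_iff_lt_conjP (k + 1) (conjP f k)
  omega

lemma IsPartition.conjP_eq_zero {f : ℕ → ℕ} (hf : IsPartition f) {k : ℕ} (hk : f 0 ≤ k) :
    conjP f k = 0 := by
  have := hf.lt_iff_lt_conjP k 0
  omega

lemma IsPartition.plen_eq {f : ℕ → ℕ} (hf : IsPartition f) : plen f = conjP f 0 := by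
  have h1 : f (plen f) = 0 := Nat.sInf_mem (s := {n | f n = 0}) hf.2
  have h2 := hf.lt_iff_lt_conjP 0 (plen f)
  have h3 := hf.lt_iff_lt_conjP 0 (conjP f 0)
  have h4 : plen f ≤ conjP f 0 := Nat.sInf_le (show f (conjP f 0) = 0 by omega)
  omega

lemma antitone_complP {f : ℕ → ℕ} (hf : Antitone f) (m : ℕ) : Antitone (complP m f) := by
  refine antitone_nat_of_succ_le fun i => ?_
  have := hf (show m - 1 - (i + 1) ≤ m - 1 - i by omega)
  unfold complP
  split_ifs <;> omega

lemma rot_decr {m i : ℕ} (q W : ℕ) (f : ℕ → ℕ) (hi : i < m) :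
    rot m q W (decr f i) = decr (rot m q W f) (q + i) := by
  funext r
  simp only [rot, decr]
  split_ifs <;> omega

/-- The features of the partitions `ν` and `μ` used in the comparison of their Littlewood–Richardson
coefficients. -/
structure RowAddition (nu mu : ℕ → ℕ) (s : ℕ) : Prop where
  isPartition : IsPartition nu
  one_le : 1 ≤ s
  first : s + 2 ≤ nu 0
  upper : s + 1 ≤ nu (s - 1)
  row : nu s = 1
  lower : nu (s + 1) = 1
  add_row : mu s = nu s + 1
  add_ne : ∀ j, j ≠ s → mu j = nu j

lemma RowAddition.of_decomp {nu beta alpha : ℕ → ℕ} {s : ℕ} (h : IsType2Decomp nu beta s alpha)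
    (hb : beta 0 = 1) : RowAddition nu (fun j => beta j + squareP1 s j + alpha j) s := by
  obtain ⟨⟨hbeta, M, hM⟩, ⟨halpha, M', hM'⟩, hs, ha0, hlen, hshape, hnu⟩ := h
  have hb1 : ∀ j, j ≤ s + 1 → beta j = 1 := by
    intro j hj
    have h1 := hshape j
    have h2 := hbeta (Nat.zero_le j)
    rw [hb, betaShape, if_pos hj] at h1
    omega
  have ha : ∀ j, s ≤ j → alpha j = 0 := by
    intro j hj
    have h1 : alpha (plen alpha) = 0 := Nat.sInf_mem (s := {n | alpha n = 0}) ⟨M', hM'⟩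
    have h2 := halpha (hlen.trans hj)
    omega
  refine ⟨⟨?_, M + M' + s, ?_⟩, hs, ?_, ?_, ?_, ?_, ?_, ?_⟩
  · refine antitone_nat_of_succ_le fun j => ?_
    have h1 := hbeta (Nat.le_succ j)
    have h2 := halpha (Nat.le_succ j)
    simp only [hnu, squareP, Nat.succ_eq_add_one] at *
    split_ifs <;> omega
  · have h1 := hbeta (show M ≤ M + M' + s by omega)
    have h2 := ha (M + M' + s) (by omega)
    rw [hnu, squareP, if_neg (by omega)]
    omega
  · rw [hnu, hb, squareP, if_pos (by omega)]
    omega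
  · rw [hnu, hb1 _ (by omega), squareP, if_pos (by omega)]
    omega
  · rw [hnu, hb1 _ (by omega), squareP, if_neg (by omega), ha s le_rfl]
  · rw [hnu, hb1 _ (by omega), squareP, if_neg (by omega), ha _ (by omega)]
  · simp [hnu, squareP, squareP1]
    omega
  · intro j hj
    simp only [hnu, squareP, squareP1, if_neg hj]

section rowAddition

variable {nu mu : ℕ → ℕ} {s : ℕ}

lemma RowAddition.isPartition_mu (h : RowAddition nu mu s) : IsPartition mu := by
  obtain ⟨⟨hanti, M, hM⟩, hs, -, hup, hrow, hlow, hadd, hne⟩ := h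
  refine ⟨antitone_nat_of_succ_le fun j => ?_, M, ?_⟩
  · have h1 := hanti (Nat.le_succ j)
    simp only [Nat.succ_eq_add_one] at h1
    by_cases hj : j = s
    · subst hj
      rw [hne _ (by omega)]
      omega
    · by_cases hj' : j + 1 = s
      · subst hj'
        rw [hne j hj]
        rw [Nat.add_sub_cancel] at hup
        omega
      · rw [hne j hj, hne _ hj']
        exact h1
  · have h1 : M ≠ s := by
      rintro rfl
      omega
    rw [hne M h1, hM]

lemma RowAddition.conjP_mu (h : RowAddition nu mu s) :
    conjP nu 1 = s ∧ conjP mu 1 = s + 1 ∧ ∀ k, k ≠ 1 → conjP mu k = conjP nu k := by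
  have hnu := h.isPartition.lt_iff_lt_conjP
  have hmu := h.isPartition_mu.lt_iff_lt_conjP
  have hs := h.one_le
  have h1 := h.upper
  have h2 := h.row
  have h3 := h.lower
  have h4 := h.add_row
  have h5 := h.add_ne (s + 1) (by omega)
  refine ⟨?_, ?_, fun k hk => ?_⟩
  · have := hnu 1 s
    have := hnu 1 (s - 1)
    omega
  · have := hmu 1 s
    have := hmu 1 (s + 1)
    omega
  · have hiff : ∀ i, k < mu i ↔ k < nu i := by
      intro i
      by_cases hi : i = s
      · subst hi
        omega
      · rw [h.add_ne i hi]
    have e1 := hiff (conjP mu k)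
    have e2 := hiff (conjP nu k)
    rw [hmu, hnu] at e1 e2
    omega

lemma RowAddition.complP_mu (h : RowAddition nu mu s) {m : ℕ} (hm : s + 1 ≤ m) :
    complP m mu = decr (complP m nu) (m - 1 - s) := by
  funext i
  simp only [decr, complP]
  by_cases hi : i = m - 1 - s
  · rw [if_pos hi, if_pos (by omega), if_pos (by omega), show m - 1 - i = s by omega, h.add_row,
      Nat.sub_sub]
  · rw [if_neg hi]
    by_cases him : i < m
    · rw [if_pos him, if_pos him, h.add_ne _ (by omega)]
    · rw [if_neg him, if_neg him]

lemma RowAddition.ncard_le (h : RowAddition nu mu s) {m q n : ℕ} (hm : nu 0 + conjP nu 0 ≤ m)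
    (hq : 1 ≤ q) (hn : nu 0 ≤ n) {lam : ℕ → ℕ} (hlam : Antitone lam) (hR : lam (m + q) = 0) :
    (lrChains n lam (complP m nu) (m + q) (conjP nu)).ncard ≤
      (lrChains n lam (complP m mu) (m + q) (conjP mu)).ncard := by
  obtain ⟨hc1, hc2, hc3⟩ := h.conjP_mu
  have hs := h.one_le
  have hfirst := h.first
  have hlen : s + 2 ≤ conjP nu 0 := by
    have := h.isPartition.lt_iff_lt_conjP 0 (s + 1)
    have := h.lower
    omega
  have hmu0 : mu 0 = nu 0 := h.add_ne 0 (by omega)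
  have hlast : complP m nu (m - 1) = m - nu 0 := by
    rw [complP, if_pos (by omega), Nat.sub_self]
  have hlast' : complP m mu (m - 1) = m - nu 0 := by
    rw [complP, if_pos (by omega), Nat.sub_self, hmu0]
  by_cases hfit : lam m ≤ m - nu 0
  swap
  · have : lrChains n lam (complP m nu) (m + q) (conjP nu) = ∅ := by
      refine Set.eq_empty_of_forall_notMem fun L hL => hfit ?_
      have := lam_le_content hL (m := m) (by rw [complP, if_neg (by omega)]) (by omega)
      omega
    rw [this, Set.ncard_empty]
    exact Nat.zero_le _
  have hz : ∀ r, m + q ≤ r → lam r = 0 := fun r hr => by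
    have := hlam hr
    omega
  have hcompl : ∀ (f : ℕ → ℕ) r, m ≤ r → complP m f r = 0 := fun f r hr => by
    rw [complP, if_neg (by omega)]
  rw [ncard_lrChains_rot (W := lam 0) h.isPartition.antitone_conjP
      (fun k hk => h.isPartition.conjP_eq_zero (hn.trans hk)) hz (hcompl nu) (hlast ▸ hfit) le_rfl,
    ncard_lrChains_rot (W := lam 0) h.isPartition_mu.antitone_conjP
      (fun k hk => h.isPartition_mu.conjP_eq_zero (by omega)) hz (hcompl mu) (hlast' ▸ hfit) le_rfl,
    h.complP_mu (by omega), rot_decr q _ _ (by omega),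
    show q + m = (q + (m - 1 - s)) + s + 1 by omega]
  have hrot : ∀ j, j < m → rot m q (lam 0) (complP m nu) (q + (m - 1 - j)) = m - nu j := by
    intro j hj
    rw [rot, if_neg (by omega), if_pos (by omega), complP, if_pos (by omega)]
    congr 2
    omega
  have e0 := hrot s (by omega)
  have e1 := hrot (s + 1) (by omega)
  have e2 := hrot (s - 1) (by omega)
  have H : ShiftHyp (q + (m - 1 - s)) s (rot m q (lam 0) lam) (rot m q (lam 0) (complP m nu))
      (conjP nu) := by
    have u1 := h.row
    have u2 := h.lower
    have u3 := h.upper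
    refine ⟨by omega, hs, ?_, ?_, by omega, ?_, hlen, hc1, ?_⟩
    · rw [rot, if_neg (by omega), if_neg (by omega)]
    · rw [e0, show q + (m - 1 - s) - 1 = q + (m - 1 - (s + 1)) by omega, e1, u1, u2]
    · have u4 := h.isPartition.1 (Nat.zero_le (s - 1))
      rw [e0, show q + (m - 1 - s) + 1 = q + (m - 1 - (s - 1)) by omega, e2]
      omega
    · have := h.isPartition.lt_iff_lt_conjP (s + 1) 0
      omega
  exact H.ncard_le (hc3 0 (by omega)) (by rw [hc1, hc2]) fun k hk => hc3 k (by omega)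

lemma RowAddition.covers (h : RowAddition nu mu s) : Covers mu nu := by
  intro m hm lam hlam
  have hmu := h.isPartition_mu
  have hmu0 : mu 0 = nu 0 := h.add_ne 0 (by have := h.one_le; omega)
  rw [hmu.plen_eq, hmu0, h.conjP_mu.2.2 0 (by omega)] at hm
  obtain ⟨hanti, M, hM⟩ := hlam
  have hR : lam (m + (M + 1)) = 0 := by
    have := hanti (show M ≤ m + (M + 1) by omega)
    omega
  unfold LRcoeff
  split_ifs with h1 h2 h2
  · rw [card_lrTableau (n := nu 0) (antitone_complP h.isPartition.1 m) hanti h1 hR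
        fun k hk => h.isPartition.conjP_eq_zero hk,
      card_lrTableau (n := nu 0) (antitone_complP hmu.1 m) hanti h2 hR
        fun k hk => hmu.conjP_eq_zero (by omega)]
    exact h.ncard_le hm (by omega) le_rfl hanti hR
  · refine absurd (fun i => ?_) h2
    have hle : ∀ j, nu j ≤ mu j := fun j => by
      by_cases hj : j = s
      · rw [hj, h.add_row]
        omega
      · rw [h.add_ne j hj]
    have h3 := h1 i
    have h4 := hle (m - 1 - i)
    unfold complP at *
    split_ifs at * <;> omega
  · exact Nat.zero_le _
  · exact le_rfl

end rowAddition

/-- a type-2 partition `ν = β + (s^s) + α` with `β₁ = 1` is covered by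
`μ = β + (s^s, 1) + α`. -/
theorem type2_beta_one_covered (nu beta alpha : ℕ → ℕ) (s : ℕ)
    (h : IsType2Decomp nu beta s alpha) (hb : beta 0 = 1) :
    Covers (fun j => beta j + squareP1 s j + alpha j) nu :=
  (RowAddition.of_decomp h hb).covers
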